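/- arXiv:2412.20205 — 2 statements merged into one kernel-verified Lean document; each statement's English description precedes it below -/
import Mathlib

section
/- Let t : ℤ → ℝ be a nondecreasing knot sequence and let N^p_j denote the B-splines defined by the Cox–de Boor recursion. If j ∈ ℤ satisfies t_j < t_{j+1} and x ∈ ℝ satisfies t_j ≤ x < t_{j+1}, then ∑_{i=j−p}^{j} N^p_i(x) = 1 (partition of unity of the B-splines of degree p on a nonempty knot span). -/
/-- The B-splines defined by the Cox–de Boor recursion on a knot sequence `t`,
with the convention that division by zero gives zero. -/
noncomputable def coxDeBoor (t : ℤ → ℝ) : ℕ → ℤ → ℝ → ℝ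
  | 0, j, x => if t j ≤ x ∧ x < t (j + 1) then 1 else 0
  | p + 1, j, x =>
      (x - t j) / (t (j + p + 1) - t j) * coxDeBoor t p j x +
        (t (j + p + 2) - x) / (t (j + p + 2) - t (j + 1)) * coxDeBoor t p (j + 1) x

/-- The B-spline of degree `p` with index `i` vanishes outside `[t_i, t_{i+p+1})`. -/
theorem coxDeBoor_eq_zero {t : ℤ → ℝ} (ht : Monotone t) {x : ℝ} (p : ℕ) (i : ℤ)
    (h : x < t i ∨ t (i + p + 1) ≤ x) : coxDeBoor t p i x = 0 := by
  induction p generalizing i with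
  | zero =>
    rw [coxDeBoor, if_neg]
    rintro ⟨h₁, h₂⟩
    simp only [Nat.cast_zero, add_zero] at h
    rcases h with h | h <;> linarith
  | succ p ih =>
    have hl : coxDeBoor t p i x = 0 := by
      refine ih i (h.imp_right fun h => le_trans (ht ?_) h)
      push_cast
      lia
    have hr : coxDeBoor t p (i + 1) x = 0 := by
      refine ih (i + 1) (h.imp (fun h => h.trans_le (ht ?_)) fun h => le_trans (ht ?_) h) <;>
        lia
    rw [coxDeBoor, hl, hr, mul_zero, mul_zero, add_zero]

/-- Partition of unity: on a nonempty knot span `[t_j, t_{j+1})`, the degree-`p`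
B-splines `N^p_{j-p}, …, N^p_j` sum to `1`. -/
theorem stmt_8 (t : ℤ → ℝ) (ht : Monotone t) (p : ℕ) (j : ℤ) (x : ℝ)
    (hj : t j < t (j + 1)) (hx₁ : t j ≤ x) (hx₂ : x < t (j + 1)) :
    ∑ i ∈ Finset.Icc (j - p) j, coxDeBoor t p i x = 1 := by
  induction p with
  | zero => simp only [Nat.cast_zero, sub_zero, Finset.Icc_self, Finset.sum_singleton, coxDeBoor, hx₁, hx₂,
      and_self, if_true]
  | succ p ih =>
    have hzero : ∀ i ∉ Finset.Icc (j - p) j, coxDeBoor t p i x = 0 := by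
      intro i hi
      rw [Finset.mem_Icc, not_and_or] at hi
      refine coxDeBoor_eq_zero ht p i (hi.symm.imp (fun hi => hx₂.trans_le (ht ?_))
        fun hi => le_trans (ht ?_) hx₁) <;> lia
    simp only [coxDeBoor]
    rw [Finset.sum_add_distrib]
    have hleft : ∑ i ∈ Finset.Icc (j - (p + 1 : ℕ)) j,
        (x - t i) / (t (i + p + 1) - t i) * coxDeBoor t p i x =
        ∑ i ∈ Finset.Icc (j - p) j,
          (x - t i) / (t (i + p + 1) - t i) * coxDeBoor t p i x := by
      refine (Finset.sum_subset (Finset.Icc_subset_Icc ?_ le_rfl) fun i _ hi => ?_).symm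
      · push_cast
        lia
      · rw [hzero i hi, mul_zero]
    have hright : ∑ i ∈ Finset.Icc (j - (p + 1 : ℕ)) j,
        (t (i + p + 2) - x) / (t (i + p + 2) - t (i + 1)) * coxDeBoor t p (i + 1) x =
        ∑ i ∈ Finset.Icc (j - p) j,
          (t (i + p + 1) - x) / (t (i + p + 1) - t i) * coxDeBoor t p i x := by
      rw [Finset.sum_subset (s₁ := Finset.Icc (j - p) j)
        (Finset.Icc_subset_Icc_right (by lia : j ≤ j + 1))
        fun i _ hi => by rw [hzero i hi, mul_zero]]
      refine Finset.sum_bij (fun i _ => i + 1) (fun i hi => ?_) (fun _ _ _ _ h => by lia)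
        (fun i hi => ⟨i - 1, ?_, by lia⟩) fun i _ => ?_
      · simp only [Finset.mem_Icc, Nat.cast_add, Nat.cast_one] at hi ⊢
        lia
      · simp only [Finset.mem_Icc, Nat.cast_add, Nat.cast_one] at hi ⊢
        lia
      · rw [show i + 1 + p + 1 = i + p + 2 by ring]
    rw [hleft, hright, ← Finset.sum_add_distrib, ← ih]
    refine Finset.sum_congr rfl fun i hi => ?_
    rw [Finset.mem_Icc] at hi
    have h₁ : t i ≤ t j := ht hi.2
    have h₂ : t (j + 1) ≤ t (i + p + 1) := ht (by lia)
    have h₃ : t (i + p + 1) - t i ≠ 0 := by linarith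
    rw [← add_mul, ← add_div, show x - t i + (t (i + p + 1) - x) = t (i + p + 1) - t i by ring,
      div_self h₃, one_mul]
end

section
/- Let s_k, …, s_{k+q+1} ∈ ℝ^N and set Δs_i = s_{i+1} − s_i and Δ²s_i = Δs_{i+1} − Δs_i. Let ΔS₊ be the N×(q+1) matrix with columns Δs_k, …, Δs_{k+q}, let e = (1, …, 1)ᵀ ∈ ℝ^{q+1}, and suppose the Gram matrix M = ΔS₊ᵀ·ΔS₊ is invertible. Let d = M⁻¹·e and λ = ⟨e, d⟩. Then λ > 0, and the vector γ = d/λ satisfies the RRE defining equations: ∑_{j=0}^{q} γ_j = 1 and ⟨Δ²s_{k+i}, ∑_{j=0}^{q} γ_j Δs_{k+j}⟩ = 0 for all i = 0, …, q−1. (This establishes the correctness of the coefficient computation in the RRE algorithm, where the linear system Rᵀ·R·d = e with ΔS₊ = Q·R is solved and γ = d/λ.) -/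
open Matrix

/-- If the Gram matrix `Aᵀ * A` is invertible, then `d = (Aᵀ * A)⁻¹ * b` solves the normal
equations `Aᵀ * (A * d) = b`. -/
theorem transpose_mulVec_mulVec_gram_inv {m n : Type*} [Fintype m] [Fintype n] [DecidableEq n]
    (A : Matrix m n ℝ) (hA : IsUnit (Aᵀ * A)) (b : n → ℝ) :
    Aᵀ *ᵥ (A *ᵥ ((Aᵀ * A)⁻¹ *ᵥ b)) = b := by
  rw [mulVec_mulVec, mulVec_mulVec,
    mul_nonsing_inv _ ((isUnit_iff_isUnit_det _).mp hA), one_mulVec]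

/-- Correctness of the RRE coefficient computation: if the Gram matrix
`M = ΔSpᵀ ΔSp` is invertible, `d = M⁻¹ e` and `λ = ⟨e, d⟩`, then `λ > 0` and
`γ = d/λ` satisfies the RRE defining equations. -/
theorem stmt_13 (N q k : ℕ) (s : ℕ → Fin N → ℝ)
    (ΔSp : Matrix (Fin N) (Fin (q + 1)) ℝ)
    (hΔSp : ∀ (i : Fin N) (c : Fin (q + 1)), ΔSp i c = s (k + c + 1) i - s (k + c) i)
    (hM : IsUnit (ΔSpᵀ * ΔSp))
    (d : Fin (q + 1) → ℝ) (hd : d = (ΔSpᵀ * ΔSp)⁻¹.mulVec (fun _ => 1))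
    (lam : ℝ) (hlam : lam = ∑ j, d j) :
    0 < lam ∧
    (∑ j : Fin (q + 1), d j / lam) = 1 ∧
    (∀ i : Fin q,
      ((s (k + i + 2) - s (k + i + 1)) - (s (k + i + 1) - s (k + i))) ⬝ᵥ
        (∑ j : Fin (q + 1), (d j / lam) • (s (k + j + 1) - s (k + j))) = 0) := by
  have hw : ΔSpᵀ *ᵥ (ΔSp *ᵥ d) = fun _ => 1 := by
    rw [hd]; exact transpose_mulVec_mulVec_gram_inv ΔSp hM _
  have hlam' : lam = (ΔSp *ᵥ d) ⬝ᵥ (ΔSp *ᵥ d) := by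
    rw [dotProduct_mulVec, ← mulVec_transpose, hw, hlam]
    simp [dotProduct]
  have hpos : 0 < lam := by
    have hnonneg : 0 ≤ lam := by
      rw [hlam']; exact Finset.sum_nonneg fun i _ => mul_self_nonneg _
    refine hnonneg.lt_of_ne fun h0 => ?_
    have hzero : ΔSp *ᵥ d = 0 := dotProduct_self_eq_zero.mp (hlam'.symm.trans h0.symm)
    rw [hzero, mulVec_zero] at hw
    exact zero_ne_one (congrFun hw 0)
  refine ⟨hpos, ?_, fun i => ?_⟩
  · rw [← Finset.sum_div, ← hlam, div_self hpos.ne']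
  · have hcol : ∀ c : Fin (q + 1), s (k + c + 1) - s (k + c) = ΔSpᵀ c := fun c =>
      funext fun l => (hΔSp l c).symm
    have hone : ∀ c : Fin (q + 1), (s (k + c + 1) - s (k + c)) ⬝ᵥ (ΔSp *ᵥ d) = 1 := fun c => by
      rw [hcol]; exact congrFun hw c
    have hsum : ∑ j : Fin (q + 1), (d j / lam) • (s (k + j + 1) - s (k + j))
        = lam⁻¹ • (ΔSp *ᵥ d) := by
      ext l
      simp only [hcol, Finset.sum_apply, Pi.smul_apply, smul_eq_mul, transpose_apply, mulVec,
        dotProduct, Finset.mul_sum]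
      exact Finset.sum_congr rfl fun j _ => by ring
    have hsucc := hone i.succ
    have hcast := hone i.castSucc
    simp only [Fin.val_succ, Fin.val_castSucc, ← add_assoc] at hsucc hcast
    rw [hsum, dotProduct_smul, sub_dotProduct, hcast, hsucc, sub_self, smul_zero]
end
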